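/- Let N ≥ 2 and let f₁, f₂ be integers such that x ↦ f₁x + f₂x² is a bijection of ℤ_N, and assume additionally that f₁ is odd in the case N ≡ 2 (mod 4). Then for every integer k ≥ 1, gcd(f₁ + k·f₂, N) = 1; equivalently, the residue of f₁ + k·f₂ is a unit of the ring ℤ_N. -/

import Mathlib

/-- A quadratic polynomial permuting `ZMod N` is injective modulo every nonzero divisor of `N`. -/
theorem quadratic_injective_of_dvd {N d : ℕ} [NeZero d] (hd : d ∣ N) (f₁ f₂ : ℤ)
    (h : Function.Surjective
      (fun x : ZMod N => (f₁ : ZMod N) * x + (f₂ : ZMod N) * x ^ 2)) :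
    Function.Injective
      (fun x : ZMod d => (f₁ : ZMod d) * x + (f₂ : ZMod d) * x ^ 2) := by
  refine Finite.injective_iff_surjective.mpr fun y => ?_
  obtain ⟨z, rfl⟩ := ZMod.castHom_surjective hd y
  obtain ⟨x, rfl⟩ := h z
  exact ⟨ZMod.castHom hd (ZMod d) x, by simp only [map_add, map_mul, map_pow, map_intCast]⟩

/-- If `x ↦ f₁ x + f₂ x²` is a bijection of `ℤ_N` (with `f₁` odd when
`N ≡ 2 (mod 4)`), then for every integer `k ≥ 1`, `gcd(f₁ + k f₂, N) = 1`;
equivalently, the residue of `f₁ + k f₂` in `ℤ_N` is a unit. -/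
theorem f1_add_k_f2_is_unit (N : ℕ) (hN : 2 ≤ N) (f₁ f₂ : ℤ)
    (hQPP : Function.Bijective
      (fun x : ZMod N => (f₁ : ZMod N) * x + (f₂ : ZMod N) * x ^ 2))
    (hodd : N % 4 = 2 → Odd f₁) :
    ∀ k : ℤ, 1 ≤ k →
      Int.gcd (f₁ + k * f₂) (N : ℤ) = 1 ∧ IsUnit ((f₁ + k * f₂ : ℤ) : ZMod N) := by
  intro k _
  have hgcd : Int.gcd (f₁ + k * f₂) (N : ℤ) = 1 := by
    by_contra hne
    obtain ⟨p, hp, hpg⟩ := Nat.exists_prime_and_dvd hne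
    have : Fact p.Prime := ⟨hp⟩
    have hpN : p ∣ N := by
      exact_mod_cast (Int.natCast_dvd_natCast.mpr hpg).trans (Int.gcd_dvd_right _ _)
    have hpf : (p : ℤ) ∣ f₁ + k * f₂ :=
      (Int.natCast_dvd_natCast.mpr hpg).trans (Int.gcd_dvd_left _ _)
    have hinj := quadratic_injective_of_dvd hpN f₁ f₂ hQPP.surjective
    have hzero : (f₁ : ZMod p) + k * f₂ = 0 := by
      exact_mod_cast (ZMod.intCast_zmod_eq_zero_iff_dvd _ p).mpr hpf
    have hk : (k : ZMod p) = 0 := hinj (by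
      dsimp only
      linear_combination (k : ZMod p) * hzero)
    have hf₁ : (f₁ : ZMod p) = 0 := by simpa [hk] using hzero
    have hneg : (1 : ZMod p) = -1 := hinj (by simp [hf₁])
    have htwo : ((2 : ℕ) : ZMod p) = 0 := by
      push_cast
      linear_combination hneg
    have hp2 : p = 2 :=
      (Nat.prime_dvd_prime_iff_eq hp Nat.prime_two).mp ((ZMod.natCast_eq_zero_iff 2 p).mp htwo)
    subst hp2
    have heven : (2 : ℤ) ∣ f₁ := by
      exact_mod_cast (ZMod.intCast_zmod_eq_zero_iff_dvd f₁ 2).mp hf₁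
    have h4 : 4 ∣ N := by
      by_contra h
      obtain ⟨m, hm⟩ := hodd (by omega)
      omega
    have hinj4 := quadratic_injective_of_dvd h4 f₁ f₂ hQPP.surjective
    obtain ⟨c, rfl⟩ := heven
    have hfour : (4 : ZMod 4) = 0 := by decide
    have : (2 : ZMod 4) = 0 := hinj4 (by
      push_cast
      linear_combination ((c : ZMod 4) + f₂) * hfour)
    exact absurd this (by decide)
  exact ⟨hgcd, (ZMod.coe_int_isUnit_iff_isCoprime _ N).mpr
    (Int.isCoprime_iff_gcd_eq_one.mpr hgcd).symm⟩
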